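/- Let W be a Coxeter group. The standard language 𝓛 satisfies condition (i) of the definition of biautomaticity: for every g ∈ W there exists a word v ∈ 𝓛 representing g. -/

import Mathlib

namespace CoxeterPaper

open CoxeterSystem

attribute [local instance] Classical.propDecidable

variable {B : Type} [DecidableEq B] [Fintype B]
variable {W : Type} [Group W] {M : CoxeterMatrix B}

/-- The right descent set `T(g) = {s ∈ S : ℓ(gs) < ℓ(g)}`, as a set of indices. -/
def descentSet (cs : CoxeterSystem M W) (g : W) : Set B :=
  {i | cs.IsRightDescent g i}

/-- The subgroup `⟨T(g)⟩` generated by the right descent set of `g`. -/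
def descSubgroup (cs : CoxeterSystem M W) (g : W) : Subgroup W :=
  Subgroup.closure (cs.simple '' descentSet cs g)

/-- `w(g)`: the longest element of `⟨T(g)⟩` (defined via choice; for `g ≠ 1` the
subgroup `⟨T(g)⟩` is finite and has a unique longest element). -/
noncomputable def wg (cs : CoxeterSystem M W) (g : W) : W :=
  if h : ∃ w₀ ∈ descSubgroup cs g, ∀ u ∈ descSubgroup cs g, cs.length u ≤ cs.length w₀
  then h.choose else 1

/-- `Π(g) = g · w(g)`. -/
noncomputable def PiMap (cs : CoxeterSystem M W) (g : W) : W := g * wg cs g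

/-- The standard language `𝓛 ⊆ S*`: the empty word is in `𝓛` (and it is the only word of `𝓛`
representing the identity); a word `v` of length `n` representing `g ≠ 1` is in `𝓛` iff,
setting `k = ℓ(w(g))`, the prefix `v(n-k)` is in `𝓛` and `v(n-k+1, n)` represents `w(g)`. -/
inductive StdLang (cs : CoxeterSystem M W) : List B → Prop
  | nil : StdLang cs []
  | step (v : List B) (hne : cs.wordProd v ≠ 1)
      (hpre : StdLang cs (v.take (v.length - cs.length (wg cs (cs.wordProd v)))))
      (hsuf : cs.wordProd (v.drop (v.length - cs.length (wg cs (cs.wordProd v))))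
        = wg cs (cs.wordProd v)) : StdLang cs v

/-- A Coxeter group is 2-dimensional if every triple of distinct generators
generates an infinite subgroup. -/
def TwoDimensional (cs : CoxeterSystem M W) : Prop :=
  ∀ i j k : B, i ≠ j → i ≠ k → j ≠ k →
    Infinite (Subgroup.closure {cs.simple i, cs.simple j, cs.simple k} : Subgroup W)

/-- The wall of the reflection `ρ` separates `g` and `h`. -/
def Separates (cs : CoxeterSystem M W) (ρ g h : W) : Prop :=
  Xor' (cs.length (ρ * g) < cs.length g) (cs.length (ρ * h) < cs.length h)

/-- `h` is adjacent to the wall of the reflection `ρ`. -/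
def AdjacentWall (cs : CoxeterSystem M W) (ρ h : W) : Prop :=
  ∃ i : B, ρ = h * cs.simple i * h⁻¹

/-- The wall of `ρ'` separates `g` from the wall of `ρ`. -/
def SeparatesFromWall (cs : CoxeterSystem M W) (ρ' g ρ : W) : Prop :=
  ∀ h : W, AdjacentWall cs ρ h → Separates cs ρ' g h

/-- `𝓦(g)`: the set of walls (identified with their reflections) separating `g` from the
identity and not separated from `g` by any other wall. -/
def WallsNear (cs : CoxeterSystem M W) (g : W) : Set W :=
  {ρ | cs.IsReflection ρ ∧ cs.length (ρ * g) < cs.length g ∧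
    ∀ ρ' : W, cs.IsReflection ρ' → ρ' ≠ ρ → ¬ SeparatesFromWall cs ρ' g ρ}

/-- The simple reflection `s i` acts on `W × ZMod 2` by conjugation on the first factor, flipping
the sign exactly at `s i`. -/
noncomputable def signedConj (cs : CoxeterSystem M W) (i : B) : Function.End (W × ZMod 2) :=
  fun p ↦ (cs.simple i * p.1 * cs.simple i, p.2 + if p.1 = cs.simple i then 1 else 0)

theorem signedConj_mul_pow_apply (cs : CoxeterSystem M W) (i j : B) (k : ℕ) (p : W × ZMod 2) :
    ((signedConj cs i * signedConj cs j) ^ k) p =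
      ((cs.simple i * cs.simple j) ^ k * p.1 * ((cs.simple i * cs.simple j) ^ k)⁻¹,
        p.2 + ∑ l ∈ Finset.range (2 * k),
          if p.1 = cs.simple j * (cs.simple i * cs.simple j) ^ l then 1 else 0) := by
  induction k with
  | zero =>
    change p = _
    simp
  | succ k ih =>
    have hmul (q : W × ZMod 2) : (signedConj cs i * signedConj cs j) q =
        signedConj cs i (signedConj cs j q) := rfl
    have hs (l : ℕ) : (cs.simple i * cs.simple j) ^ l * cs.simple j *
        (cs.simple i * cs.simple j) ^ l = cs.simple j := by
      induction l with
      | zero => simp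
      | succ l ih =>
        calc _ = cs.simple i * cs.simple j * ((cs.simple i * cs.simple j) ^ l * cs.simple j *
              (cs.simple i * cs.simple j) ^ l) * (cs.simple i * cs.simple j) := by
              nth_rw 1 [pow_succ']
              rw [pow_succ]
              simp only [mul_assoc]
          _ = _ := by
            rw [ih]
            simp [mul_assoc]
    have hconj (t x : W) : (cs.simple i * cs.simple j) ^ k * t *
        ((cs.simple i * cs.simple j) ^ k)⁻¹ = cs.simple j * x ↔
        t = cs.simple j * ((cs.simple i * cs.simple j) ^ k * x *
          (cs.simple i * cs.simple j) ^ k) := by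
      have h := congrArg (· * (x * (cs.simple i * cs.simple j) ^ k)) (hs k).symm
      simp only [mul_assoc] at h
      rw [mul_inv_eq_iff_eq_mul, mul_assoc, h, mul_right_inj]
      simp only [mul_assoc]
    have hfst (t : W) : (cs.simple i * cs.simple j) ^ k * t * ((cs.simple i * cs.simple j) ^ k)⁻¹ =
        cs.simple j ↔ t = cs.simple j * (cs.simple i * cs.simple j) ^ (2 * k) := by
      have h := hconj t 1
      rwa [mul_one, mul_one, ← pow_add, ← two_mul] at h
    have hmove (x : W) : cs.simple j * x * cs.simple j = cs.simple i ↔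
        x = cs.simple j * (cs.simple i * cs.simple j) := by
      constructor
      · intro h
        simp [← h, mul_assoc]
      · rintro rfl
        simp [mul_assoc]
    have hsnd (t : W) : cs.simple j * ((cs.simple i * cs.simple j) ^ k * t *
        ((cs.simple i * cs.simple j) ^ k)⁻¹) * cs.simple j = cs.simple i ↔
        t = cs.simple j * (cs.simple i * cs.simple j) ^ (2 * k + 1) := by
      rw [hmove, hconj, ← pow_succ, ← pow_add, show k + 1 + k = 2 * k + 1 by ring]
    rw [pow_succ']
    change (signedConj cs i * signedConj cs j)
      (((signedConj cs i * signedConj cs j) ^ k) p) = _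
    rw [ih, hmul]
    simp only [signedConj, hfst, hsnd]
    rw [show 2 * (k + 1) = 2 * k + 1 + 1 by ring, Finset.sum_range_succ, Finset.sum_range_succ]
    refine Prod.ext ?_ ?_
    · simp [pow_succ', mul_assoc]
    · simp only [add_assoc]

theorem isLiftable_signedConj (cs : CoxeterSystem M W) : M.IsLiftable (signedConj cs) := by
  intro i j
  funext p
  have hr := cs.simple_mul_simple_pow i j
  rw [signedConj_mul_pow_apply, hr, two_mul, Finset.sum_range_add]
  simp only [pow_add, hr, one_mul, CharTwo.add_self_eq_zero, mul_one, inv_one, add_zero]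
  rfl

/-- The action of `W` on `W × ZMod 2` extending `signedConj`. -/
noncomputable def signedConjHom (cs : CoxeterSystem M W) : W →* Function.End (W × ZMod 2) :=
  cs.lift ⟨signedConj cs, isLiftable_signedConj cs⟩

/-- The inversion cocycle: on a reflection `t` it is `1` exactly when `t` is a right inversion
of `w`. -/
noncomputable def inversionSign (cs : CoxeterSystem M W) (w t : W) : ZMod 2 :=
  (signedConjHom cs w (t, 0)).2

theorem signedConjHom_simple (cs : CoxeterSystem M W) (i : B) :
    signedConjHom cs (cs.simple i) = signedConj cs i :=
  cs.lift_apply_simple _ i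

theorem signedConjHom_mul_apply (cs : CoxeterSystem M W) (u v : W) (p : W × ZMod 2) :
    signedConjHom cs (u * v) p = signedConjHom cs u (signedConjHom cs v p) := by
  rw [map_mul]
  rfl

theorem signedConjHom_apply (cs : CoxeterSystem M W) (w t : W) (ε : ZMod 2) :
    signedConjHom cs w (t, ε) = (w * t * w⁻¹, ε + inversionSign cs w t) := by
  induction w using cs.simple_induction_left generalizing t ε with
  | one =>
    rw [inversionSign, map_one]
    change (t, ε) = (_, ε + 0)
    simp
  | mul_simple_left w i ih =>
    rw [inversionSign, signedConjHom_mul_apply, signedConjHom_mul_apply, ih, ih,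
      signedConjHom_simple]
    simp [signedConj, mul_assoc, add_assoc]

theorem inversionSign_one (cs : CoxeterSystem M W) (t : W) : inversionSign cs 1 t = 0 := by
  rw [inversionSign, map_one]
  rfl

theorem inversionSign_simple (cs : CoxeterSystem M W) (i : B) (t : W) :
    inversionSign cs (cs.simple i) t = if t = cs.simple i then 1 else 0 := by
  rw [inversionSign, signedConjHom_simple]
  simp [signedConj]

theorem inversionSign_mul (cs : CoxeterSystem M W) (u v t : W) :
    inversionSign cs (u * v) t = inversionSign cs v t + inversionSign cs u (v * t * v⁻¹) := by
  rw [inversionSign, signedConjHom_mul_apply, signedConjHom_apply, signedConjHom_apply]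
  simp

theorem inversionSign_self (cs : CoxeterSystem M W) {t : W} (ht : cs.IsReflection t) :
    inversionSign cs t t = 1 := by
  obtain ⟨u, i, rfl⟩ := ht
  have h := inversionSign_mul cs u u⁻¹ (u * cs.simple i * u⁻¹)
  rw [mul_inv_cancel, inversionSign_one] at h
  rw [inversionSign_mul, inversionSign_mul]
  have hc : u⁻¹ * (u * cs.simple i * u⁻¹) * u⁻¹⁻¹ = cs.simple i := by group
  have hi : cs.simple i * cs.simple i * (cs.simple i)⁻¹ = cs.simple i := by group
  rw [hc] at h ⊢
  rw [hi, inversionSign_simple, if_pos rfl, add_left_comm, ← h, add_zero]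

theorem mem_rightInvSeq_of_inversionSign_ne_zero (cs : CoxeterSystem M W) {ω : List B} {t : W}
    (h : inversionSign cs (cs.wordProd ω) t ≠ 0) : t ∈ cs.rightInvSeq ω := by
  induction ω with
  | nil => simp [inversionSign_one] at h
  | cons i ω ih =>
    rw [cs.wordProd_cons, inversionSign_mul, inversionSign_simple] at h
    rw [rightInvSeq, List.mem_cons]
    by_cases ht : cs.wordProd ω * t * (cs.wordProd ω)⁻¹ = cs.simple i
    · left
      rw [← ht]
      group
    · right
      rw [if_neg ht, add_zero] at h
      exact ih h

theorem length_mul_lt_of_inversionSign_ne_zero (cs : CoxeterSystem M W) {w t : W}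
    (h : inversionSign cs w t ≠ 0) : cs.length (w * t) < cs.length w := by
  obtain ⟨ω, hω, rfl⟩ := cs.exists_isReduced w
  exact (cs.isRightInversion_of_mem_rightInvSeq hω
    (mem_rightInvSeq_of_inversionSign_ne_zero cs h)).2

theorem length_mul_lt_iff_inversionSign_ne_zero (cs : CoxeterSystem M W) {w t : W}
    (ht : cs.IsReflection t) :
    cs.length (w * t) < cs.length w ↔ inversionSign cs w t ≠ 0 := by
  refine ⟨fun hlt h ↦ ?_, length_mul_lt_of_inversionSign_ne_zero cs⟩
  have h' : inversionSign cs (w * t) t ≠ 0 := by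
    rw [inversionSign_mul, inversionSign_self cs ht, mul_inv_cancel_right, h]
    decide
  have := length_mul_lt_of_inversionSign_ne_zero cs h'
  rw [mul_assoc, ht.mul_self, mul_one] at this
  exact lt_asymm hlt this

/-- An element of a standard parabolic subgroup has a reduced word in the generators of that
subgroup. -/
theorem exists_isReduced_of_mem_closure (cs : CoxeterSystem M W) (T : Set B) {u : W}
    (hu : u ∈ Subgroup.closure (cs.simple '' T)) :
    ∃ ω : List B, (∀ i ∈ ω, i ∈ T) ∧ cs.IsReduced ω ∧ cs.wordProd ω = u := by
  have step (u : W) (i : B) (hi : i ∈ T)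
      (h : ∃ ω : List B, (∀ i ∈ ω, i ∈ T) ∧ cs.IsReduced ω ∧ cs.wordProd ω = u) :
      ∃ ω : List B, (∀ i ∈ ω, i ∈ T) ∧ cs.IsReduced ω ∧ cs.wordProd ω = u * cs.simple i := by
    obtain ⟨ω, hT, hω, rfl⟩ := h
    by_cases hd : cs.IsRightDescent (cs.wordProd ω) i
    · have hmem := mem_rightInvSeq_of_inversionSign_ne_zero cs
        ((length_mul_lt_iff_inversionSign_ne_zero cs (cs.isReflection_simple i)).1 hd)
      obtain ⟨j, hj, hji⟩ := List.mem_iff_getElem.1 hmem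
      have hprod := cs.wordProd_mul_getD_rightInvSeq ω j
      rw [List.getD_eq_getElem _ 1 hj, hji] at hprod
      rw [cs.length_rightInvSeq] at hj
      refine ⟨ω.eraseIdx j, fun k hk ↦ hT k (List.mem_of_mem_eraseIdx hk), ?_, hprod.symm⟩
      have h₁ := cs.isRightDescent_iff.1 hd
      have h₂ := List.length_eraseIdx_add_one hj
      have h₃ := hω.eq
      rw [CoxeterSystem.IsReduced, ← hprod]
      omega
    · have hprod : cs.wordProd (ω ++ [i]) = cs.wordProd ω * cs.simple i := by
        simp [cs.wordProd_append]
      refine ⟨ω ++ [i], ?_, ?_, hprod⟩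
      · simpa [or_imp, forall_and] using ⟨hT, hi⟩
      · have h₁ := cs.not_isRightDescent_iff.1 hd
        rw [CoxeterSystem.IsReduced, hprod, h₁, hω.eq]
        simp
  induction hu using Subgroup.closure_induction_right with
  | one => exact ⟨[], by simp, by simp [CoxeterSystem.IsReduced], by simp⟩
  | mul_right u hu s hs ih =>
    obtain ⟨i, hi, rfl⟩ := hs
    exact step u i hi ih
  | mul_inv_cancel u hu s hs ih =>
    obtain ⟨i, hi, rfl⟩ := hs
    rw [cs.inv_simple]
    exact step u i hi ih

theorem length_mul_inv_add_length (cs : CoxeterSystem M W) {g u : W}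
    (hu : u ∈ descSubgroup cs g) : cs.length (g * u⁻¹) + cs.length u = cs.length g := by
  obtain ⟨ω, hT, hω, rfl⟩ := exists_isReduced_of_mem_closure cs _ hu
  clear hu
  induction ω using List.reverseRecOn with
  | nil => simp
  | append_singleton ω i ih =>
    have hω' : cs.IsReduced ω := by simpa using hω.take ω.length
    have ih := ih (fun k hk ↦ hT k (List.mem_append_left _ hk)) hω'
    have hi : cs.IsRightDescent g i := hT i (by simp)
    have hprod : cs.wordProd (ω ++ [i]) = cs.wordProd ω * cs.simple i := by
      simp [cs.wordProd_append]
    have hlen := hω.eq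
    have hlen' := hω'.eq
    rw [List.length_append, List.length_singleton] at hlen
    set u := cs.wordProd ω with hu
    have hgi := (length_mul_lt_iff_inversionSign_ne_zero cs (cs.isReflection_simple i)).1 hi
    have hui : inversionSign cs u (cs.simple i) = 0 := by
      by_contra h
      have := length_mul_lt_of_inversionSign_ne_zero cs h
      rw [← hprod] at this
      omega
    have hsign : inversionSign cs (g * u⁻¹) (u * cs.simple i * u⁻¹) ≠ 0 := by
      rwa [← inv_mul_cancel_right g u, inversionSign_mul, hui, zero_add] at hgi
    have hlt := length_mul_lt_of_inversionSign_ne_zero cs hsign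
    have heq : g * u⁻¹ * (u * cs.simple i * u⁻¹) = g * (cs.wordProd (ω ++ [i]))⁻¹ := by
      rw [hprod, mul_inv_rev, cs.inv_simple]
      group
    rw [heq] at hlt
    have htri := cs.length_mul_le (g * (cs.wordProd (ω ++ [i]))⁻¹) (cs.wordProd (ω ++ [i]))
    rw [inv_mul_cancel_right] at htri
    omega

theorem wg_spec (cs : CoxeterSystem M W) (g : W) :
    wg cs g ∈ descSubgroup cs g ∧
      ∀ u ∈ descSubgroup cs g, cs.length u ≤ cs.length (wg cs g) := by
  have h : ∃ w₀ ∈ descSubgroup cs g, ∀ u ∈ descSubgroup cs g, cs.length u ≤ cs.length w₀ := by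
    have hfin : (cs.length '' (descSubgroup cs g : Set W)).Finite := by
      refine (Set.finite_Iic (cs.length g)).subset ?_
      rintro _ ⟨u, hu, rfl⟩
      exact (Nat.le_add_left _ _).trans (length_mul_inv_add_length cs hu).le
    obtain ⟨w₀, hw₀, hmax⟩ := Set.exists_max_image _ id hfin ⟨_, 1, one_mem _, rfl⟩
    obtain ⟨w₀, hmem, rfl⟩ := hw₀
    exact ⟨w₀, hmem, fun u hu ↦ hmax _ ⟨u, hu, rfl⟩⟩
  rw [wg, dif_pos h]
  exact h.choose_spec

theorem length_mul_wg_inv_lt (cs : CoxeterSystem M W) {g : W} (hg : g ≠ 1) :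
    cs.length (g * (wg cs g)⁻¹) < cs.length g := by
  obtain ⟨i, hi⟩ := cs.exists_rightDescent_of_ne_one hg
  obtain ⟨hmem, hmax⟩ := wg_spec cs g
  have h₁ := hmax _ (Subgroup.subset_closure ⟨i, hi, rfl⟩)
  rw [cs.length_simple] at h₁
  have h₂ := length_mul_inv_add_length cs hmem
  omega

/-- The standard language satisfies condition (i) of the definition of biautomaticity:
every element of `W` is represented by some word of `𝓛`. -/
theorem standard_language_surjective (cs : CoxeterSystem M W) (g : W) :
    ∃ v : List B, StdLang cs v ∧ cs.wordProd v = g := by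
  induction hn : cs.length g using Nat.strong_induction_on generalizing g with
  | _ n ih =>
    by_cases hg : g = 1
    · exact ⟨[], .nil, by simp [hg]⟩
    · obtain ⟨v, hv, hvg⟩ := ih _ (hn ▸ length_mul_wg_inv_lt cs hg) (g * (wg cs g)⁻¹) rfl
      obtain ⟨ω, hω, hωg⟩ := cs.exists_isReduced (wg cs g)
      have hprod : cs.wordProd (v ++ ω) = g := by
        rw [cs.wordProd_append, hvg, ← hωg, inv_mul_cancel_right]
      have hlen : (v ++ ω).length - cs.length (wg cs (cs.wordProd (v ++ ω))) = v.length := by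
        rw [hprod, hωg, hω.eq, List.length_append, Nat.add_sub_cancel]
      refine ⟨v ++ ω, .step _ (by rwa [hprod]) ?_ ?_, hprod⟩
      · rwa [hlen, List.take_left]
      · rw [hlen, List.drop_left, hprod, hωg]

end CoxeterPaper
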